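/- Let q ∈ (0,1), p ∈ ℕ, and set α_q = ⌊3q/(1−q)⌋ + 2. Then for every t ∈ ℝ, −(5q+1)/(1−q) ≤ 2q(cos t − q) Z_q²(t) − p q^p (cos(pt) − q^p) Z²_{q^p}(pt) + 1 − α_q < 0, where Z_r(u) = 1/√(1 − 2r cos u + r²). -/

import Mathlib

open Real MeasureTheory intervalIntegral

noncomputable section

/-- A modulus of continuity: continuous, nondecreasing, subadditive on `[0,∞)`, vanishing at 0. -/
def IsModulus (ω : ℝ → ℝ) : Prop :=
  ContinuousOn ω (Set.Ici 0) ∧ MonotoneOn ω (Set.Ici 0) ∧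
    (∀ s t : ℝ, 0 ≤ s → 0 ≤ t → ω (s + t) ≤ ω s + ω t) ∧ ω 0 = 0

/-- A convex upwards (i.e. concave) modulus of continuity. -/
def IsConcaveModulus (ω : ℝ → ℝ) : Prop :=
  IsModulus ω ∧ ConcaveOn ℝ (Set.Ici 0) ω

/-- The class `H_ω` of continuous `2π`-periodic functions with modulus of continuity `ω`. -/
def Hclass (ω : ℝ → ℝ) : Set (ℝ → ℝ) :=
  {φ | Continuous φ ∧ (∀ x, φ (x + 2 * π) = φ x) ∧ ∀ s t : ℝ, |φ s - φ t| ≤ ω |s - t|}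

/-- The Poisson kernel `P_{q,β}(t) = Σ_{k≥1} q^k cos(kt + βπ/2)`. -/
def Pker (q β t : ℝ) : ℝ :=
  ∑' k : ℕ, q ^ (k + 1) * Real.cos ((k + 1 : ℕ) * t + β * π / 2)

/-- The class `C^q_β H_ω` of Poisson integrals of functions from `H_ω`. -/
def CqbH (q β : ℝ) (ω : ℝ → ℝ) : Set (ℝ → ℝ) :=
  {f | ∃ A₀ : ℝ, ∃ φ ∈ Hclass ω,
      f = fun x => A₀ + (1 / π) * ∫ t in (0:ℝ)..(2 * π), φ (x + t) * Pker q β t}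

/-- Fourier cosine coefficient. -/
def coefA (f : ℝ → ℝ) (j : ℕ) : ℝ := (1 / π) * ∫ t in (0:ℝ)..(2 * π), f t * Real.cos (j * t)

/-- Fourier sine coefficient. -/
def coefB (f : ℝ → ℝ) (j : ℕ) : ℝ := (1 / π) * ∫ t in (0:ℝ)..(2 * π), f t * Real.sin (j * t)

/-- The `k`-th partial sum of the Fourier series of `f`. -/
def Ssum (f : ℝ → ℝ) (k : ℕ) (x : ℝ) : ℝ :=
  coefA f 0 / 2 +
    ∑ j ∈ Finset.Icc 1 k, (coefA f j * Real.cos (j * x) + coefB f j * Real.sin (j * x))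

/-- The de la Vallée Poussin sum `V_{n,p}(f;x) = (1/p) Σ_{k=n-p}^{n-1} S_k(f;x)`. -/
def Vsum (n p : ℕ) (f : ℝ → ℝ) (x : ℝ) : ℝ :=
  (1 / (p : ℝ)) * ∑ k ∈ Finset.Ico (n - p) n, Ssum f k x

/-- `E(N; A) = sup_{f ∈ N} ‖f - A f‖_C`. -/
def Edev (N : Set (ℝ → ℝ)) (A : (ℝ → ℝ) → ℝ → ℝ) : ℝ :=
  ⨆ f : N, ⨆ x : ℝ, |(f : ℝ → ℝ) x - A f x|

/-- The constant `K_{p,q}`. -/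
def Kpq (p : ℕ) (q : ℝ) : ℝ :=
  ∫ t in (0:ℝ)..(2 * π),
    Real.sqrt (1 - 2 * q ^ p * Real.cos (p * t) + q ^ (2 * p)) /
      (1 - 2 * q * Real.cos t + q ^ 2)

/-- `e_m(ω) = ∫₀^{π/2} ω(2t/m) sin t dt`. -/
def eInt (m : ℕ) (ω : ℝ → ℝ) : ℝ := ∫ t in (0:ℝ)..(π / 2), ω (2 * t / m) * Real.sin t

/-- `δ(p) = 2` if `p = 1`, `δ(p) = 3` otherwise. -/
def δp (p : ℕ) : ℕ := if p = 1 then 2 else 3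

/-- `Z_r(u) = 1/√(1 - 2r cos u + r²)`. -/
def Zf (r u : ℝ) : ℝ := 1 / Real.sqrt (1 - 2 * r * Real.cos u + r ^ 2)

/-- `θ_r(u) = arctan(r sin u / (1 - r cos u))`. -/
def θf (r u : ℝ) : ℝ := Real.arctan (r * Real.sin u / (1 - r * Real.cos u))

/-- The complete elliptic integral of the first kind. -/
def ellK (r : ℝ) : ℝ := ∫ t in (0:ℝ)..(π / 2), 1 / Real.sqrt (1 - r ^ 2 * Real.sin t ^ 2)

/-- `α_q = ⌊3q/(1-q)⌋ + 2`. -/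
def αq (q : ℝ) : ℕ := ⌊3 * q / (1 - q)⌋₊ + 2

theorem aux_bounds (r u : ℝ) (h0 : 0 < r) (h1 : r < 1) :
    -(r / (1 + r)) ≤ r * (Real.cos u - r) * (Zf r u) ^ 2 ∧
      r * (Real.cos u - r) * (Zf r u) ^ 2 ≤ r / (1 - r) := by
  have hc1 := Real.cos_le_one u
  have hc2 := Real.neg_one_le_cos u
  have hD : 0 < 1 - 2 * r * Real.cos u + r ^ 2 := by nlinarith [sq_pos_of_pos (sub_pos.2 h1)]
  have hZ : (Zf r u) ^ 2 = 1 / (1 - 2 * r * Real.cos u + r ^ 2) := by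
    unfold Zf
    rw [div_pow, Real.sq_sqrt hD.le, one_pow]
  have hr1 : 0 < 1 - r := sub_pos.2 h1
  have hr2 : 0 < 1 + r := by linarith
  rw [hZ, mul_one_div]
  constructor
  · rw [← neg_div, div_le_div_iff₀ hr2 hD]
    have : 0 ≤ r * ((1 - r) * (1 + Real.cos u)) := by
      apply mul_nonneg h0.le (mul_nonneg hr1.le (by linarith))
    nlinarith
  · rw [div_le_div_iff₀ hD hr1]
    have : 0 ≤ r * ((1 + r) * (1 - Real.cos u)) := by
      apply mul_nonneg h0.le (mul_nonneg hr2.le (by linarith))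
    nlinarith

theorem aux_pow (q : ℝ) (h0 : 0 < q) (h1 : q < 1) (k : ℕ) :
    ((k : ℝ) + 1) * q ^ k * (1 - q) ≤ 1 - q ^ (k + 1) := by
  induction k with
  | zero => simp
  | succ k ih =>
    have h := mul_le_mul_of_nonneg_left ih h0.le
    have h2 : q ^ (k + 1) ≤ 1 := pow_le_one₀ h0.le h1.le
    have h3 := mul_nonneg (sub_nonneg.2 h2) (sub_pos.2 h1).le
    push_cast
    rw [pow_succ q (k + 1)]
    rw [pow_succ q k] at *
    nlinarith

/-- Two-sided estimate for
`2q(cos t - q)Z_q²(t) - p q^p(cos pt - q^p)Z²_{q^p}(pt) + 1 - α_q`, where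
`α_q = ⌊3q/(1-q)⌋ + 2`. -/
theorem lambda_two_sided (q : ℝ) (hq : q ∈ Set.Ioo (0:ℝ) 1) (p : ℕ) (hp : 0 < p) (t : ℝ) :
    -((5 * q + 1) / (1 - q)) ≤
        2 * q * (Real.cos t - q) * (Zf q t) ^ 2 -
          (p : ℝ) * q ^ p * (Real.cos ((p : ℝ) * t) - q ^ p) *
            (Zf (q ^ p) ((p : ℝ) * t)) ^ 2 + 1 - (αq q : ℝ) ∧
      2 * q * (Real.cos t - q) * (Zf q t) ^ 2 -
          (p : ℝ) * q ^ p * (Real.cos ((p : ℝ) * t) - q ^ p) *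
            (Zf (q ^ p) ((p : ℝ) * t)) ^ 2 + 1 - (αq q : ℝ) < 0 := by
  obtain ⟨h0, h1⟩ := hq
  have hr1 : 0 < 1 - q := sub_pos.2 h1
  have hP0 : 0 < q ^ p := pow_pos h0 p
  have hP1 : q ^ p < 1 := pow_lt_one₀ h0.le h1 hp.ne'
  obtain ⟨a1, a2⟩ := aux_bounds q t h0 h1
  obtain ⟨b1, b2⟩ := aux_bounds (q ^ p) (p * t) hP0 hP1
  have hpp : (0 : ℝ) < p := by exact_mod_cast hp
  have key : (p : ℝ) * q ^ p * (1 - q) ≤ q * (1 - q ^ p) := by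
    obtain ⟨k, rfl⟩ : ∃ k, p = k + 1 := ⟨p - 1, by omega⟩
    have := mul_le_mul_of_nonneg_left (aux_pow q h0 h1 k) h0.le
    push_cast
    calc _ = q * (((k : ℝ) + 1) * q ^ k * (1 - q)) := by ring
      _ ≤ _ := this
  have hU : (p : ℝ) * (q ^ p / (1 - q ^ p)) ≤ q / (1 - q) := by
    rw [← mul_div_assoc, div_le_div_iff₀ (sub_pos.2 hP1) hr1]
    exact key
  have hL : (p : ℝ) * (q ^ p / (1 + q ^ p)) ≤ q / (1 - q) := by
    refine le_trans (mul_le_mul_of_nonneg_left ?_ hpp.le) hU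
    exact div_le_div_of_nonneg_left hP0.le (sub_pos.2 hP1) (by linarith)
  have hq' : q / (1 + q) ≤ q / (1 - q) :=
    div_le_div_of_nonneg_left h0.le hr1 (by linarith)
  have c1 := mul_le_mul_of_nonneg_left b1 hpp.le
  have c2 := mul_le_mul_of_nonneg_left b2 hpp.le
  have e3 : 3 * q / (1 - q) = 3 * (q / (1 - q)) := mul_div_assoc _ _ _
  have e5 : (5 * q + 1) / (1 - q) = 1 + 6 * (q / (1 - q)) := by
    field_simp
    ring
  have f1 : ((⌊3 * q / (1 - q)⌋₊ : ℕ) : ℝ) ≤ 3 * q / (1 - q) :=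
    Nat.floor_le (by positivity)
  have f2 := Nat.lt_floor_add_one (3 * q / (1 - q))
  have hα : (αq q : ℝ) = (⌊3 * q / (1 - q)⌋₊ : ℕ) + 2 := by
    unfold αq
    push_cast
    rfl
  rw [hα, e5]
  rw [e3] at *
  constructor <;> nlinarith
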